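/- Fix d ≥ 2 and a function F: ℕ^d → ℤ_{>0}. Suppose B: ℕ^d → ℕ satisfies: B(n·e_1) = n for all n ∈ ℕ, and for every δ ∈ ℕ^d not of the form n·e_1, B(δ) is the maximum of |δ| together with the values B(δ') where δ' ranges over all simple F-decompositions of δ. Then B(δ) = max{n : δ ↣ n·e_1} for every δ ∈ ℕ^d. -/

import Mathlib

/-- `δ'` is a simple `F`-decomposition of `δ` (in some degree `i ≥ 2`):
`δ' = δ - e_i + F(δ)·(e_1 + ⋯ + e_{i-1})`.  Coordinates are indexed by `Fin d`,
where index `j` corresponds to degree `j+1`. -/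
def SimpleDec {d : ℕ} (F : (Fin d → ℕ) → ℕ) (δ δ' : Fin d → ℕ) : Prop :=
  ∃ i : Fin d, 0 < (i : ℕ) ∧ 0 < δ i ∧
    δ' = fun j => if j = i then δ j - 1 else if (j : ℕ) < (i : ℕ) then δ j + F δ else δ j

/-- `δ ↣ δ'`: `δ'` is obtained from `δ` by a finite (possibly empty) sequence of
simple `F`-decompositions. -/
def Dec {d : ℕ} (F : (Fin d → ℕ) → ℕ) : (Fin d → ℕ) → (Fin d → ℕ) → Prop :=
  Relation.ReflTransGen (SimpleDec F)

/-- The vector `n · e_1`. -/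
def unitVec (d n : ℕ) : Fin d → ℕ := fun j => if (j : ℕ) = 0 then n else 0

theorem wellFounded_simpleDec {d : ℕ} (F : (Fin d → ℕ) → ℕ) :
    WellFounded fun δ' δ => SimpleDec F δ δ' := by
  refine Subrelation.wf (r := Pi.Lex (fun a b : Fin d => b < a) (fun {_} (a b : ℕ) => a < b)) ?_
    (Pi.Lex.wellFounded (fun a b : Fin d => b < a) fun _ => wellFounded_lt)
  rintro δ' δ ⟨i, _, hδ, rfl⟩
  refine ⟨i, fun j hj => ?_, ?_⟩
  · have h : (i : ℕ) < j := hj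
    simp [hj.ne', h.not_gt]
  · simpa using hδ

theorem not_simpleDec_unitVec {d : ℕ} (F : (Fin d → ℕ) → ℕ) (n : ℕ) (δ' : Fin d → ℕ) :
    ¬ SimpleDec F (unitVec d n) δ' := by
  rintro ⟨i, hi, hpos, _⟩
  simp [unitVec, hi.ne'] at hpos

theorem sum_unitVec {d : ℕ} (hd : 0 < d) (n : ℕ) : ∑ i, unitVec d n i = n := by
  rw [Finset.sum_eq_single (⟨0, hd⟩ : Fin d)]
  · simp [unitVec]
  · intro b _ hb
    have : (b : ℕ) ≠ 0 := fun h => hb (Fin.ext h)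
    simp [unitVec, this]
  · simp

theorem exists_simpleDec {d : ℕ} (hd : 0 < d) (F : (Fin d → ℕ) → ℕ) {δ : Fin d → ℕ}
    (hδ : ¬ ∃ n : ℕ, δ = unitVec d n) : ∃ δ', SimpleDec F δ δ' := by
  by_contra h
  refine hδ ⟨δ ⟨0, hd⟩, funext fun j => ?_⟩
  by_cases hj : (j : ℕ) = 0
  · have : j = ⟨0, hd⟩ := Fin.ext hj
    simp [unitVec, this]
  · have : δ j = 0 := by
      by_contra hne
      exact h ⟨_, j, Nat.pos_of_ne_zero hj, Nat.pos_of_ne_zero hne, rfl⟩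
    simp [unitVec, hj, this]

theorem SimpleDec.sum_le {d : ℕ} {F : (Fin d → ℕ) → ℕ} {δ δ' : Fin d → ℕ}
    (hF : 0 < F δ) (h : SimpleDec F δ δ') : ∑ i, δ i ≤ ∑ i, δ' i := by
  obtain ⟨i, hi, _, rfl⟩ := h
  have hd : 0 < d := i.pos
  have hle : ∑ j, (δ j + unitVec d 1 j) ≤ ∑ j, ((if j = i then δ j - 1 else
      if (j : ℕ) < (i : ℕ) then δ j + F δ else δ j) + if j = i then 1 else 0) := by
    refine Finset.sum_le_sum fun j _ => ?_
    by_cases hj : j = i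
    · subst hj
      simp only [unitVec, if_true, hi.ne', if_false]
      omega
    · simp only [unitVec, hj, if_false]
      split_ifs <;> omega
  rw [Finset.sum_add_distrib, Finset.sum_add_distrib, sum_unitVec hd] at hle
  simpa using hle

/-- If `B : ℕ^d → ℕ` satisfies `B (n·e_1) = n`, and for every `δ` not of the form
`n·e_1` the value `B δ` is the maximum of `|δ|` together with the values `B δ'`
over all simple `F`-decompositions `δ'` of `δ`, then
`B δ = max {n : δ ↣ n·e_1}` for every `δ`. -/
theorem B_eq_max_dec (d : ℕ) (hd : 2 ≤ d) (F : (Fin d → ℕ) → ℕ) (hF : ∀ δ, 0 < F δ)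
    (B : (Fin d → ℕ) → ℕ)
    (hB1 : ∀ n : ℕ, B (unitVec d n) = n)
    (hB2 : ∀ δ : Fin d → ℕ, (¬ ∃ n : ℕ, δ = unitVec d n) →
      IsGreatest ({∑ i, δ i} ∪ {m : ℕ | ∃ δ', SimpleDec F δ δ' ∧ m = B δ'}) (B δ)) :
    ∀ δ : Fin d → ℕ, IsGreatest {n : ℕ | Dec F δ (unitVec d n)} (B δ) := by
  have hd0 : 0 < d := by omega
  have hsum : ∀ δ : Fin d → ℕ, ∑ i, δ i ≤ B δ := by
    intro δ
    by_cases hδ : ∃ n : ℕ, δ = unitVec d n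
    · obtain ⟨n, rfl⟩ := hδ
      rw [sum_unitVec hd0, hB1]
    · exact (hB2 δ hδ).2 (Or.inl rfl)
  intro δ
  induction δ using (wellFounded_simpleDec F).induction with
  | _ δ ih =>
    by_cases hδ : ∃ n : ℕ, δ = unitVec d n
    · obtain ⟨n, rfl⟩ := hδ
      rw [hB1]
      refine ⟨Relation.ReflTransGen.refl, fun m hm => ?_⟩
      rcases Relation.ReflTransGen.cases_head hm with h | ⟨δ', h, _⟩
      · have := congrArg B h
        rw [hB1, hB1] at this
        exact this.ge
      · exact absurd h (not_simpleDec_unitVec F n δ')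
    · obtain ⟨hmem, hub⟩ := hB2 δ hδ
      have hle : ∀ δ', SimpleDec F δ δ' → B δ' ≤ B δ := fun δ' h => hub (Or.inr ⟨δ', h, rfl⟩)
      refine ⟨?_, fun m hm => ?_⟩
      · obtain ⟨δ', h, hB⟩ : ∃ δ', SimpleDec F δ δ' ∧ B δ = B δ' := by
          rcases hmem with hmem | hmem
          · obtain ⟨δ', h⟩ := exists_simpleDec hd0 F hδ
            have hmem : B δ = ∑ i, δ i := hmem
            exact ⟨δ', h, le_antisymm (hmem ▸ (h.sum_le (hF δ)).trans (hsum δ')) (hle δ' h)⟩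
          · exact hmem
        rw [hB]
        exact Relation.ReflTransGen.head h (ih δ' h).1
      · rcases Relation.ReflTransGen.cases_head hm with h | ⟨δ', h, h'⟩
        · exact absurd ⟨m, h⟩ hδ
        · exact ((ih δ' h).2 h').trans (hle δ' h)
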